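/- arXiv:2107.14504 — 3 statements merged into one kernel-verified Lean document; each statement's English description precedes it below -/
import Mathlib

section
/- Let (S_n)_{n≥0} be a random walk started at 0 with i.i.d. increments having a continuous symmetric probability density ρ, and let M_n = max_{1≤k≤n} S_k. Then for every n ≥ 2, E[M_n δ_0(S_n)] = (n/2) ∫_0^∞ x ∑_{k=1}^{n-1} ρ^{*k}(x) ρ^{*(n−k)}(x)/(k(n−k)) dx, and this quantity is 0 for n = 0,1. (Kac's formula.) -/
open MeasureTheory

/-- `convN ρ n` is the `(n+1)`-fold convolution `ρ^{*(n+1)}` of `ρ` with itself. -/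
noncomputable def convN (ρ : ℝ → ℝ) : ℕ → ℝ → ℝ
  | 0 => ρ
  | n+1 => fun x => ∫ y, convN ρ n (x - y) * ρ y

/-- For `x : Fin m → ℝ`, `ext x i` is the `i`-th point of the bridge path:
`x_{i}` for `1 ≤ i ≤ m` and `0` otherwise (in particular at `i = 0` and `i = m+1`). -/
noncomputable def ext {m : ℕ} (x : Fin m → ℝ) (i : ℕ) : ℝ :=
  if h : 1 ≤ i ∧ i ≤ m then x ⟨i-1, by omega⟩ else 0

/-- running maximum -/
noncomputable def rmax (s : ℕ → ℝ) : ℕ → ℝ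
  | 0 => s 0
  | n+1 => max (rmax s n) (s (n+1))

/-- partial sums -/
noncomputable def psum (a : ℕ → ℝ) (k : ℕ) : ℝ := ∑ i ∈ Finset.range k, a i

lemma rmax_congr {s t : ℕ → ℝ} {n : ℕ} (h : ∀ k ≤ n, s k = t k) : rmax s n = rmax t n := by
  induction n with
  | zero => simp [rmax, h 0 le_rfl]
  | succ n ih => rw [rmax, rmax, ih (fun k hk => h k (by omega)), h _ le_rfl]

lemma le_rmax (s : ℕ → ℝ) {n k : ℕ} (h : k ≤ n) : s k ≤ rmax s n := by
  induction n with
  | zero => obtain rfl : k = 0 := by omega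
            simp [rmax]
  | succ n ih =>
    rw [rmax]
    rcases Nat.lt_or_ge n k with h' | h'
    · obtain rfl : k = n+1 := by omega
      exact le_max_right _ _
    · exact (ih h').trans (le_max_left _ _)

lemma rmax_psum_nonneg (a : ℕ → ℝ) (n : ℕ) : 0 ≤ rmax (psum a) n := by
  simpa [psum] using le_rmax (psum a) (Nat.zero_le n)

lemma rmax_psum_succ' (a : ℕ → ℝ) (n : ℕ) :
    rmax (psum a) (n+1) = max 0 (a 0 + rmax (psum (fun i => a (i+1))) n) := by
  induction n with
  | zero => simp [rmax, psum]
  | succ n ih =>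
    rw [rmax, ih, rmax, max_assoc, ← max_add_add_left]
    congr 3
    simp only [psum]
    rw [Finset.sum_range_succ' _ (n+1), add_comm]

/-- cyclic identity -/
lemma cyclic (b : ℕ → ℝ) (p : ℕ) (hb : ∀ i, b (i + (p+1)) = b i) :
    ∑ j ∈ Finset.range (p+1), rmax (psum (fun i => b (i+j))) (p+1)
      = ∑ j ∈ Finset.range (p+1), rmax (psum (fun i => b (i+j))) p
        + max 0 (psum b (p+1)) := by
  have hS : ∀ j, psum (fun i => b (i+j)) (p+1) = psum b (p+1) := by
    intro j
    induction j with
    | zero => simp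
    | succ j ih =>
      rw [← ih]
      simp only [psum]
      rw [Finset.sum_range_succ, Finset.sum_range_succ']
      have := hb j
      congr 1
      · refine Finset.sum_congr rfl fun i _ => ?_
        congr 1; ring
      · rw [zero_add, ← this]; congr 1; omega
  rcases le_or_gt (psum b (p+1)) 0 with h | h
  · rw [max_eq_left h, add_zero]
    refine Finset.sum_congr rfl fun j _ => ?_
    rw [rmax, hS, max_eq_left (h.trans (rmax_psum_nonneg _ _))]
  · rw [max_eq_right h.le]
    have key : ∀ j, rmax (psum (fun i => b (i+j))) (p+1)
        = b j + rmax (psum (fun i => b (i+(j+1)))) p := by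
      intro j
      rw [rmax_psum_succ', max_eq_right]
      · simp only [zero_add]
        congr 4
        funext i; congr 1; ring
      · have h1 := le_rmax (psum (fun i => b (i+1+j))) (le_refl p)
        have h2 := hS j
        rw [psum, Finset.sum_range_succ'] at h2
        rw [← h2] at h
        rw [psum] at h1
        linarith
    simp_rw [key]
    rw [Finset.sum_add_distrib, add_comm]
    congr 1
    have := Finset.sum_range_succ' (fun j => rmax (psum (fun i => b (i+j))) p) (p+1)
    rw [Finset.sum_range_succ] at this
    simp only [add_zero, hb] at this
    linarith

/-- the cyclic shift of the first `p` coordinates -/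
noncomputable def sig (N p j : ℕ) (hp : p ≤ N) (hj : j < p) : Equiv.Perm (Fin N) :=
  Equiv.ofBijective
    (fun i => if h : i.1 < p then
      (if h' : i.1 + j < p then ⟨i.1 + j, by omega⟩ else ⟨i.1 + j - p, by omega⟩) else i)
    (Finite.injective_iff_bijective.mp (by
      intro a b hab
      have := congrArg Fin.val hab
      apply Fin.ext
      simp only at this
      split_ifs at this <;> (try simp only at this) <;> omega))

lemma ext_succ {N : ℕ} (y : Fin N → ℝ) (i : ℕ) (h : i < N) : ext y (i+1) = y ⟨i, h⟩ := by
  simp [ext, h]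

lemma ext_sig {N p j : ℕ} (hp : p ≤ N) (hj : j < p) (y : Fin N → ℝ) (i : ℕ) (hi : i < p) :
    ext (fun k => y (sig N p j hp hj k)) (i+1) = ext y ((i+j)%p+1) := by
  have : (i+j)%p < p := Nat.mod_lt _ (by omega)
  rw [ext_succ _ i (by omega), ext_succ _ _ (by omega)]
  congr 1
  apply Fin.ext
  simp only [sig, Equiv.ofBijective_apply, hi, dite_true]
  split_ifs with h
  · simp [Nat.mod_eq_of_lt h]
  · rw [Nat.mod_eq_sub_mod (by omega), Nat.mod_eq_of_lt (by omega)]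

/-- running maximum of the partial sums of the increments -/
noncomputable def MX {N : ℕ} (y : Fin N → ℝ) (m : ℕ) : ℝ := rmax (psum (fun i => ext y (i+1))) m

lemma cyclic_fin {N p : ℕ} (hp : p + 1 ≤ N) (y : Fin N → ℝ) :
    ∑ j : Fin (p+1), MX (fun k => y (sig N (p+1) j hp j.2 k)) (p+1)
     = ∑ j : Fin (p+1), MX (fun k => y (sig N (p+1) j hp j.2 k)) p
       + max 0 (psum (fun i => ext y (i+1)) (p+1)) := by
  have := cyclic (fun i => ext y (i % (p+1) + 1)) p (by intro i; simp)
  rw [Finset.sum_range, Finset.sum_range] at this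
  have hpp : psum (fun i => ext y (i % (p+1) + 1)) (p+1) = psum (fun i => ext y (i+1)) (p+1) := by
    refine Finset.sum_congr rfl fun i hi => ?_
    simp only [Nat.mod_eq_of_lt (Finset.mem_range.mp hi)]
  rw [hpp] at this
  have h2 : ∀ (m : ℕ) (_ : m ≤ p+1) (j : Fin (p+1)), MX (fun k => y (sig N (p+1) j hp j.2 k)) m
      = rmax (psum (fun i => ext y ((i+j) % (p+1) + 1))) m := by
    intro m hm j
    refine rmax_congr fun k hk => Finset.sum_congr rfl fun i hi => ?_
    have := Finset.mem_range.mp hi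
    exact ext_sig hp j.2 y i (by omega)
  simp_rw [h2 (p+1) le_rfl, h2 p (Nat.le_succ p)]
  exact this

lemma MX_nonneg {N : ℕ} (y : Fin N → ℝ) (m : ℕ) : 0 ≤ MX y m := rmax_psum_nonneg _ _

@[fun_prop]
lemma measurable_ext {N : ℕ} (i : ℕ) : Measurable (fun y : Fin N → ℝ => ext y i) := by
  unfold ext
  split_ifs <;> fun_prop

@[fun_prop]
lemma measurable_psum {N : ℕ} (k : ℕ) :
    Measurable (fun y : Fin N → ℝ => psum (fun i => ext y (i+1)) k) := by
  unfold psum; fun_prop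

@[fun_prop]
lemma measurable_MX {N : ℕ} (m : ℕ) : Measurable (fun y : Fin N → ℝ => MX y m) := by
  unfold MX
  induction m with
  | zero => simp only [rmax]; fun_prop
  | succ m ih => simp only [rmax]; exact ih.max (measurable_psum _)

lemma psum_full {N : ℕ} (y : Fin N → ℝ) : psum (fun i => ext y (i+1)) N = ∑ i, y i := by
  rw [psum, Finset.sum_range]
  exact Finset.sum_congr rfl fun i _ => ext_succ y i i.2

open scoped ENNReal

/-- weight -/
noncomputable def wt (q : ℝ → ℝ≥0∞) {N : ℕ} (y : Fin N → ℝ) : ℝ≥0∞ := (∏ i, q (y i)) * q (∑ i, y i)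

lemma measurable_wt {q : ℝ → ℝ≥0∞} (hq : Measurable q) {N : ℕ} :
    Measurable (fun y : Fin N → ℝ => wt q y) := by
  unfold wt; fun_prop

lemma lintegral_perm {N : ℕ} (σ : Equiv.Perm (Fin N)) (F : (Fin N → ℝ) → ℝ≥0∞) :
    ∫⁻ y : Fin N → ℝ, F (fun k => y (σ k)) = ∫⁻ y : Fin N → ℝ, F y := by
  have h := volume_measurePreserving_piCongrLeft (fun _ : Fin N => ℝ) σ.symm
  rw [← h.lintegral_comp_emb (MeasurableEquiv.measurableEmbedding _) F]
  refine lintegral_congr fun y => ?_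
  congr 1
  funext k
  simp [MeasurableEquiv.piCongrLeft, Equiv.piCongrLeft, Equiv.piCongrLeft']

lemma G_step {q : ℝ → ℝ≥0∞} (hq : Measurable q) {N p : ℕ} (hp : p + 1 ≤ N) :
    ((p+1 : ℕ) : ℝ≥0∞) * ∫⁻ y : Fin N → ℝ, ENNReal.ofReal (MX y (p+1)) * wt q y
     = ((p+1 : ℕ) : ℝ≥0∞) * (∫⁻ y : Fin N → ℝ, ENNReal.ofReal (MX y p) * wt q y)
       + ∫⁻ y : Fin N → ℝ, ENNReal.ofReal (psum (fun i => ext y (i+1)) (p+1)) * wt q y := by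
  have hw := measurable_wt hq (N := N)
  have hinv : ∀ (σ : Equiv.Perm (Fin N)) (y : Fin N → ℝ), wt q (fun k => y (σ k)) = wt q y := by
    intro σ y
    simp only [wt]
    rw [Equiv.prod_comp σ (fun i => q (y i)), Equiv.sum_comp σ (fun i => y i)]
  have hmS : ∀ (σ : Equiv.Perm (Fin N)) (m : ℕ),
      Measurable (fun y : Fin N → ℝ => ENNReal.ofReal (MX (fun k => y (σ k)) m) * wt q y) := by
    intro σ m
    have : Measurable (fun y : Fin N → ℝ => MX (fun k => y (σ k)) m) :=
      (measurable_MX m).comp (by fun_prop)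
    fun_prop
  have hsum : ∀ m, ((p+1 : ℕ) : ℝ≥0∞) * ∫⁻ y : Fin N → ℝ, ENNReal.ofReal (MX y m) * wt q y
      = ∫⁻ y : Fin N → ℝ, ENNReal.ofReal
          (∑ j : Fin (p+1), MX (fun k => y (sig N (p+1) j hp j.2 k)) m) * wt q y := by
    intro m
    simp_rw [ENNReal.ofReal_sum_of_nonneg (fun i _ => MX_nonneg _ _), Finset.sum_mul]
    rw [lintegral_finsetSum _ (fun j _ => hmS _ m)]
    rw [Finset.sum_congr rfl (g := fun _ => ∫⁻ y : Fin N → ℝ, ENNReal.ofReal (MX y m) * wt q y)]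
    · simp
    · intro j _
      rw [← lintegral_perm (sig N (p+1) j hp j.2)
        (fun y => ENNReal.ofReal (MX y m) * wt q y)]
      simp_rw [hinv]
  rw [hsum, hsum, ← lintegral_add_right _ (by fun_prop)]
  refine lintegral_congr fun y => ?_
  rw [cyclic_fin, ENNReal.ofReal_add (Finset.sum_nonneg fun _ _ => MX_nonneg _ _)
    (le_max_left _ _), add_mul]
  congr 2
  rcases le_total 0 (psum (fun i => ext y (i+1)) (p+1)) with h | h
  · rw [max_eq_right h]
  · rw [max_eq_left h, ENNReal.ofReal_of_nonpos h, ENNReal.ofReal_zero]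

/-- `ℝ≥0∞`-valued iterated convolution -/
noncomputable def lcv (q : ℝ → ℝ≥0∞) : ℕ → ℝ → ℝ≥0∞
  | 0 => q
  | n+1 => fun x => ∫⁻ y, lcv q n (x - y) * q y

lemma measurable_lcv {q : ℝ → ℝ≥0∞} (hq : Measurable q) (n : ℕ) : Measurable (lcv q n) := by
  induction n with
  | zero => exact hq
  | succ n ih =>
    unfold lcv
    refine Measurable.lintegral_prod_right' (f := fun z : ℝ × ℝ => lcv q n (z.1 - z.2) * q z.2) ?_
    fun_prop

/-- averaging operator -/
noncomputable def avg (q f : ℝ → ℝ≥0∞) (x : ℝ) : ℝ≥0∞ := ∫⁻ z, f (x + z) * q z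

lemma measurable_avg {q f : ℝ → ℝ≥0∞} (hq : Measurable q) (hf : Measurable f) :
    Measurable (avg q f) := by
  refine Measurable.lintegral_prod_right' (f := fun z : ℝ × ℝ => f (z.1 + z.2) * q z.2) ?_
  fun_prop

lemma avg_lcv {q : ℝ → ℝ≥0∞} (hs : ∀ x, q (-x) = q x) (n : ℕ) :
    avg q (lcv q n) = lcv q (n+1) := by
  funext x
  rw [avg, lcv, ← lintegral_neg_eq_self]
  refine lintegral_congr fun z => ?_
  rw [hs, sub_eq_add_neg]

lemma lintegral_avg {q g : ℝ → ℝ≥0∞} (hq : Measurable q) (hg : Measurable g) (n : ℕ) :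
    ∫⁻ x, avg q g x * lcv q n x = ∫⁻ x, g x * lcv q (n+1) x := by
  have hr := measurable_lcv hq n
  have h1 : ∀ x, avg q g x * lcv q n x = ∫⁻ z, g (x + z) * q z * lcv q n x := by
    intro x
    rw [avg, lintegral_mul_const _ (by fun_prop)]
  have h2 : ∀ x, g x * lcv q (n+1) x = ∫⁻ z, g x * (lcv q n (x - z) * q z) := by
    intro x
    rw [lcv, lintegral_const_mul _ (by fun_prop)]
  simp_rw [h1, h2]
  rw [lintegral_lintegral_swap (by fun_prop)]
  conv_rhs => rw [lintegral_lintegral_swap (by fun_prop)]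
  refine lintegral_congr fun z => ?_
  rw [← lintegral_add_right_eq_self (fun x => g x * (lcv q n (x - z) * q z)) z]
  refine lintegral_congr fun x => ?_
  rw [add_sub_cancel_right]
  ring

/-- strip the last coordinate -/
lemma strip {q f g : ℝ → ℝ≥0∞} (hq : Measurable q) (hf : Measurable f) (hg : Measurable g)
    {N m : ℕ} (hm : m ≤ N) :
    ∫⁻ y : Fin (N+1) → ℝ, g (psum (fun i => ext y (i+1)) m) * ((∏ i, q (y i)) * f (∑ i, y i))
    = ∫⁻ y : Fin N → ℝ, g (psum (fun i => ext y (i+1)) m) *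
        ((∏ i, q (y i)) * avg q f (∑ i, y i)) := by
  have h := (volume_preserving_piFinSuccAbove (fun _ : Fin (N+1) => ℝ) (Fin.last N)).symm
  rw [← h.lintegral_comp_emb (MeasurableEquiv.measurableEmbedding _)]
  have hps : ∀ (y : Fin N → ℝ) (z : ℝ),
      psum (fun i => ext (Fin.snoc (α := fun _ => ℝ) y z : Fin (N+1) → ℝ) (i+1)) m
        = psum (fun i => ext y (i+1)) m := by
    intro y z
    refine Finset.sum_congr rfl fun i hi => ?_
    have := Finset.mem_range.mp hi
    show ext _ (i+1) = ext y (i+1)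
    rw [ext_succ _ i (by omega), ext_succ _ i (by omega)]
    exact Fin.snoc_castSucc (α := fun _ => ℝ) z y ⟨i, by omega⟩
  have hF : ∀ w : ℝ × (Fin N → ℝ),
      g (psum (fun i => ext ((MeasurableEquiv.piFinSuccAbove (fun _ : Fin (N+1) => ℝ)
          (Fin.last N)).symm w) (i+1)) m)
        * ((∏ i, q ((MeasurableEquiv.piFinSuccAbove (fun _ : Fin (N+1) => ℝ)
          (Fin.last N)).symm w i)) * f (∑ i, (MeasurableEquiv.piFinSuccAbove
            (fun _ : Fin (N+1) => ℝ) (Fin.last N)).symm w i))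
      = g (psum (fun i => ext w.2 (i+1)) m) * ((∏ i, q (w.2 i)) * (f (∑ i, w.2 i + w.1) * q w.1)) := by
    rintro ⟨z, y⟩
    have : (MeasurableEquiv.piFinSuccAbove (fun _ : Fin (N+1) => ℝ) (Fin.last N)).symm (z, y)
        = (Fin.snoc (α := fun _ => ℝ) y z : Fin (N+1) → ℝ) := by
      exact Fin.insertNth_last' z y
    rw [this, hps, Fin.prod_univ_castSucc, Fin.sum_univ_castSucc]
    simp only [Fin.snoc_castSucc, Fin.snoc_last]
    ring
  have hmeas : Measurable (fun w : ℝ × (Fin N → ℝ) =>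
      g (psum (fun i => ext w.2 (i+1)) m) *
        ((∏ i, q (w.2 i)) * (f (∑ i, w.2 i + w.1) * q w.1))) := by
    have : Measurable (fun w : ℝ × (Fin N → ℝ) => psum (fun i => ext w.2 (i+1)) m) :=
      (measurable_psum m).comp measurable_snd
    fun_prop
  rw [lintegral_congr hF]
  rw [Measure.volume_eq_prod, lintegral_prod_symm' _ hmeas]
  refine lintegral_congr fun y => ?_
  dsimp only
  rw [lintegral_const_mul _ (by fun_prop), lintegral_const_mul _ (by fun_prop), avg]

lemma lemA {q : ℝ → ℝ≥0∞} (hq : Measurable q) (n : ℕ) : ∀ {g : ℝ → ℝ≥0∞}, Measurable g →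
    ∫⁻ y : Fin (n+1) → ℝ, ((∏ i, q (y i)) * g (∑ i, y i)) = ∫⁻ x, g x * lcv q n x := by
  induction n with
  | zero =>
    intro g hg
    have := strip hq hg (g := fun _ => 1) measurable_const (N := 0) (m := 0) le_rfl
    simp only [one_mul] at this
    rw [this]
    simp [avg, lcv, volume_pi]
  | succ n ih =>
    intro g hg
    have := strip hq hg (g := fun _ => 1) measurable_const (N := n+1) (m := 0) (by omega)
    simp only [one_mul] at this
    rw [this, ih (measurable_avg hq hg), lintegral_avg hq hg]

lemma lemB {q g : ℝ → ℝ≥0∞} (hq : Measurable q) (hs : ∀ x, q (-x) = q x) (hg : Measurable g)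
    (m l : ℕ) : ∀ j : ℕ,
    ∫⁻ y : Fin (m+1+l) → ℝ, g (psum (fun i => ext y (i+1)) (m+1)) *
        ((∏ i, q (y i)) * lcv q j (∑ i, y i))
      = ∫⁻ x, g x * (lcv q m x * lcv q (l+j) x) := by
  induction l with
  | zero =>
    intro j
    have := lemA hq m (hg.mul (measurable_lcv hq j))
    calc _ = ∫⁻ y : Fin (m+1) → ℝ, ((∏ i, q (y i)) * (g (∑ i, y i) * lcv q j (∑ i, y i))) := by
          refine lintegral_congr fun y => ?_
          rw [psum_full]; ring
      _ = _ := by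
          refine this.trans (lintegral_congr fun x => ?_)
          rw [zero_add, Pi.mul_apply]; ring
  | succ l ih =>
    intro j
    have := strip hq (measurable_lcv hq j) hg (N := m+1+l) (m := m+1) (by omega)
    rw [avg_lcv hs, ih (j+1)] at this
    rw [show l+1+j = l+(j+1) by ring]
    exact this

lemma G_formula {q : ℝ → ℝ≥0∞} (hq : Measurable q) (hs : ∀ x, q (-x) = q x) {N : ℕ} :
    ∀ p ≤ N, ∫⁻ y : Fin N → ℝ, ENNReal.ofReal (MX y p) * wt q y
     = ∑ k ∈ Finset.range p, ((k+1 : ℕ) : ℝ≥0∞)⁻¹ *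
        ∫⁻ x, ENNReal.ofReal x * (lcv q k x * lcv q (N - (k+1)) x) := by
  intro p hp
  induction p with
  | zero => simp [MX, rmax, psum]
  | succ p ih =>
    have h1 := G_step hq hp
    have hB := lemB hq hs ENNReal.measurable_ofReal p (N - (p+1)) 0
    rw [show p+1+(N-(p+1)) = N by omega, add_zero] at hB
    have h2 : ∫⁻ y : Fin N → ℝ, ENNReal.ofReal (psum (fun i => ext y (i+1)) (p+1)) * wt q y
       = ∫⁻ x, ENNReal.ofReal x * (lcv q p x * lcv q (N - (p+1)) x) := hB
    rw [h2] at h1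
    rw [Finset.sum_range_succ, ← ih (by omega)]
    have hc0 : ((p+1 : ℕ) : ℝ≥0∞) ≠ 0 := by simp
    have hct : ((p+1 : ℕ) : ℝ≥0∞) ≠ ∞ := ENNReal.natCast_ne_top _
    have h3 := congrArg (fun t => ((p+1 : ℕ) : ℝ≥0∞)⁻¹ * t) h1
    simp only [mul_add, ← mul_assoc, ENNReal.inv_mul_cancel hc0 hct, one_mul] at h3
    simpa only [mul_assoc] using h3

lemma sym_sum {N : ℕ} (H : ℕ → ℝ≥0∞) (hH : ∀ k, 1 ≤ k → k ≤ N → H (N+1-k) = H k) :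
    2 * ∑ k ∈ Finset.Icc 1 N, (k : ℝ≥0∞)⁻¹ * H k
      = ((N+1 : ℕ) : ℝ≥0∞) * ∑ k ∈ Finset.Icc 1 N, ((k * (N+1-k) : ℕ) : ℝ≥0∞)⁻¹ * H k := by
  have hr : ∑ k ∈ Finset.Icc 1 N, (k : ℝ≥0∞)⁻¹ * H k
      = ∑ k ∈ Finset.Icc 1 N, ((N+1-k : ℕ) : ℝ≥0∞)⁻¹ * H k := by
    refine Finset.sum_bij' (fun k _ => N+1-k) (fun k _ => N+1-k) ?_ ?_ ?_ ?_ ?_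
    · intro k hk; simp only [Finset.mem_Icc] at hk ⊢; omega
    · intro k hk; simp only [Finset.mem_Icc] at hk ⊢; omega
    · intro k hk; simp only [Finset.mem_Icc] at hk ⊢; omega
    · intro k hk; simp only [Finset.mem_Icc] at hk ⊢; omega
    · intro k hk
      simp only [Finset.mem_Icc] at hk
      rw [hH k hk.1 hk.2, show N+1-(N+1-k) = k by omega]
  rw [two_mul]
  nth_rewrite 2 [hr]
  rw [← Finset.sum_add_distrib, Finset.mul_sum]
  refine Finset.sum_congr rfl fun k hk => ?_
  simp only [Finset.mem_Icc] at hk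
  rw [← add_mul, ← mul_assoc]
  congr 1
  obtain ⟨l, hl⟩ : ∃ l, N+1 = k+l := ⟨N+1-k, by omega⟩
  rw [hl, Nat.add_sub_cancel_left]
  have hk0 : (k : ℝ≥0∞) ≠ 0 := by simp; omega
  have hl0 : (l : ℝ≥0∞) ≠ 0 := by simp; omega
  have hkt : (k : ℝ≥0∞) ≠ ∞ := ENNReal.natCast_ne_top _
  have hlt : (l : ℝ≥0∞) ≠ ∞ := ENNReal.natCast_ne_top _
  push_cast
  rw [ENNReal.mul_inv (Or.inl hk0) (Or.inl hkt), add_mul, ← mul_assoc,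
    ENNReal.mul_inv_cancel hk0 hkt, one_mul, mul_comm (k : ℝ≥0∞)⁻¹, ← mul_assoc,
    ENNReal.mul_inv_cancel hl0 hlt, one_mul, add_comm]

lemma convN_nonneg {ρ : ℝ → ℝ} (h : ∀ x, 0 ≤ ρ x) (n : ℕ) (x : ℝ) : 0 ≤ convN ρ n x := by
  induction n generalizing x with
  | zero => exact h x
  | succ n ih => exact integral_nonneg fun y => mul_nonneg (ih _) (h _)

lemma measurable_convN {ρ : ℝ → ℝ} (h : Measurable ρ) (n : ℕ) : Measurable (convN ρ n) := by
  induction n with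
  | zero => exact h
  | succ n ih =>
    have : Measurable (fun z : ℝ × ℝ => convN ρ n (z.1 - z.2) * ρ z.2) := by fun_prop
    exact (this.stronglyMeasurable.integral_prod_right').measurable

lemma lintegral_lcv {q : ℝ → ℝ≥0∞} (hq : Measurable q) (h1 : ∫⁻ x, q x = 1) (n : ℕ) :
    ∫⁻ x, lcv q n x = 1 := by
  induction n with
  | zero => exact h1
  | succ n ih =>
    have := lintegral_avg hq (g := fun _ => 1) measurable_const n
    simp only [avg, one_mul, h1] at this
    rw [← this, ih]

lemma convN_ae {ρ : ℝ → ℝ} (hpos : ∀ x, 0 ≤ ρ x) (hm : Measurable ρ)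
    (h1 : ∫⁻ x, ENNReal.ofReal (ρ x) = 1) (n : ℕ) :
    ∀ᵐ x, ENNReal.ofReal (convN ρ n x) = lcv (fun x => ENNReal.ofReal (ρ x)) n x := by
  have hq : Measurable (fun x => ENNReal.ofReal (ρ x)) := by fun_prop
  induction n with
  | zero => exact ae_of_all _ fun x => rfl
  | succ n ih =>
    have hfin : ∀ᵐ x, lcv (fun x => ENNReal.ofReal (ρ x)) (n+1) x < ∞ :=
      ae_lt_top (measurable_lcv hq _) (by rw [lintegral_lcv hq h1]; simp)
    filter_upwards [hfin] with x hx
    have hc := measurable_convN hm n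
    have : convN ρ (n+1) x = (lcv (fun x => ENNReal.ofReal (ρ x)) (n+1) x).toReal := by
      rw [convN]
      dsimp only
      rw [integral_eq_lintegral_of_nonneg_ae (f := fun y => convN ρ n (x - y) * ρ y)
        (ae_of_all _ fun y => mul_nonneg (convN_nonneg hpos _ _) (hpos _))
        (Measurable.aestronglyMeasurable (by fun_prop)), lcv]
      congr 1
      apply lintegral_congr_ae
      have := (quasiMeasurePreserving_sub_left_of_right_invariant volume x).ae ih
      filter_upwards [this] with y hy
      rw [ENNReal.ofReal_mul (convN_nonneg hpos _ _), hy]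
    rw [this, ENNReal.ofReal_toReal hx.ne]

/-- matrix of partial sums -/
noncomputable def PM (N : ℕ) : Matrix (Fin N) (Fin N) ℝ := Matrix.of fun i j => if j ≤ i then 1 else 0

lemma det_PM (N : ℕ) : (PM N).det = 1 := by
  rw [Matrix.det_of_isLowerTriangular]
  · simp [PM]
  · intro i j hij
    have : i < j := hij
    simp [PM, this]

lemma PM_preserving (N : ℕ) : MeasurePreserving (Matrix.toLin' (PM N)) volume volume := by
  refine ⟨(LinearMap.continuous_of_finiteDimensional _).measurable, ?_⟩
  rw [Real.map_matrix_volume_pi_eq_smul_volume_pi (by rw [det_PM]; exact one_ne_zero), det_PM]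
  simp

lemma ext_PM {N : ℕ} (y : Fin N → ℝ) (k : ℕ) (hk : k ≤ N) :
    ext (Matrix.toLin' (PM N) y) k = psum (fun i => ext y (i+1)) k := by
  cases k with
  | zero => simp [ext, psum]
  | succ k =>
    rw [ext_succ _ k hk, Matrix.toLin'_apply, Matrix.mulVec, dotProduct]
    simp only [PM, Matrix.of_apply, ite_mul, one_mul, zero_mul]
    have h1 : ∀ j : Fin N, (if j ≤ (⟨k, hk⟩ : Fin N) then y j else 0)
        = (fun i => if i ≤ k then ext y (i+1) else 0) (j : ℕ) := by
      intro j
      simp only [ext_succ y j j.2, Fin.le_def]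
    rw [Finset.sum_congr rfl (fun j _ => h1 j), ← Finset.sum_range (fun i => if i ≤ k then ext y (i+1) else 0), psum, ← Finset.sum_filter]
    refine Finset.sum_congr ?_ fun _ _ => rfl
    ext i
    simp only [Finset.mem_filter, Finset.mem_range]
    omega

lemma sup_eq {N : ℕ} (x : Fin N → ℝ) (hne : (Finset.range (N+1)).Nonempty) :
    (Finset.range (N+1)).sup' hne (fun k => ext x (k+1)) = rmax (ext x) N := by
  have h0 : ext x 0 = 0 := by simp [ext]
  have hl : ext x (N+1) = 0 := by simp [ext]
  apply le_antisymm
  · apply Finset.sup'_le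
    intro k hk
    rcases Nat.lt_or_ge k N with h | h
    · exact le_rmax _ h
    · obtain rfl : k = N := by simp at hk; omega
      rw [hl, ← h0]
      exact le_rmax _ (Nat.zero_le _)
  · have : ∀ m ≤ N, rmax (ext x) m ≤ (Finset.range (N+1)).sup' hne (fun k => ext x (k+1)) := by
      intro m hm
      induction m with
      | zero =>
        rw [rmax, h0, ← hl]
        exact Finset.le_sup' (fun k => ext x (k+1)) (by simp)
      | succ m ih =>
        rw [rmax]
        exact max_le (ih (by omega)) (Finset.le_sup' (fun k => ext x (k+1)) (by simp; omega))
    exact this N le_rfl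

lemma LHS_eq {ρ : ℝ → ℝ} (hpos : ∀ x, 0 ≤ ρ x) (hm : Measurable ρ) (hs : ∀ x, ρ (-x) = ρ x)
    {N : ℕ} (hne : (Finset.range (N+1)).Nonempty) :
    ∫ x : Fin N → ℝ, ((Finset.range (N+1)).sup' hne (fun k => ext x (k+1)))
          * ∏ i ∈ Finset.range (N+1), ρ (ext x (i+1) - ext x i)
     = (∫⁻ y : Fin N → ℝ, ENNReal.ofReal (MX y N) * wt (fun x => ENNReal.ofReal (ρ x)) y).toReal := by
  simp_rw [sup_eq]
  have hmr : ∀ m, Measurable (fun x : Fin N → ℝ => rmax (ext x) m) := by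
    intro m
    induction m with
    | zero => simp only [rmax]; fun_prop
    | succ m ih => simp only [rmax]; exact ih.max (measurable_ext _)
  have hr0 : ∀ x : Fin N → ℝ, 0 ≤ rmax (ext x) N := by
    intro x
    have := le_rmax (ext x) (Nat.zero_le N)
    simpa [ext] using this
  have hmF : Measurable (fun x : Fin N → ℝ =>
      rmax (ext x) N * ∏ i ∈ Finset.range (N+1), ρ (ext x (i+1) - ext x i)) := by
    have := hmr N
    fun_prop
  rw [integral_eq_lintegral_of_nonneg_ae
    (ae_of_all _ fun x => mul_nonneg (hr0 x) (Finset.prod_nonneg fun i _ => hpos _))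
    hmF.aestronglyMeasurable]
  congr 1
  rw [← (PM_preserving N).lintegral_comp (by fun_prop)]
  refine lintegral_congr fun y => ?_
  have hM : rmax (ext (Matrix.toLin' (PM N) y)) N = MX y N :=
    rmax_congr fun k hk => ext_PM y k hk
  rw [hM, ENNReal.ofReal_mul (MX_nonneg _ _), wt,
    ENNReal.ofReal_prod_of_nonneg (fun i _ => hpos _), Finset.prod_range_succ]
  congr 2
  · rw [Finset.prod_range]
    refine Finset.prod_congr rfl fun i _ => ?_
    rw [ext_PM y _ i.2, ext_PM y _ i.2.le, psum, psum, Finset.sum_range_succ, ext_succ y i i.2]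
    simp
  · have : ext (Matrix.toLin' (PM N) y) (N+1) = 0 := by simp [ext]
    rw [this, ext_PM y N le_rfl, psum_full, zero_sub, hs]

lemma RHS_eq {ρ : ℝ → ℝ} (hpos : ∀ x, 0 ≤ ρ x) (hm : Measurable ρ)
    (h1 : ∫⁻ x, ENNReal.ofReal (ρ x) = 1) (N : ℕ) :
    ∫ y in Set.Ioi (0:ℝ), y * ∑ k ∈ Finset.Icc 1 N,
            convN ρ (k-1) y * convN ρ (N+1-k-1) y / ((k * (N+1-k) : ℕ) : ℝ)
    = (∑ k ∈ Finset.Icc 1 N, ((k * (N+1-k) : ℕ) : ℝ≥0∞)⁻¹ *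
        ∫⁻ x, ENNReal.ofReal x * (lcv (fun x => ENNReal.ofReal (ρ x)) (k-1) x *
          lcv (fun x => ENNReal.ofReal (ρ x)) (N-k) x)).toReal := by
  have hq : Measurable (fun x => ENNReal.ofReal (ρ x)) := by fun_prop
  have hc := measurable_convN hm
  have hl := measurable_lcv hq
  have hn := convN_nonneg hpos
  have hterm : ∀ (k : ℕ) (y : ℝ),
      0 ≤ convN ρ (k-1) y * convN ρ (N+1-k-1) y / ((k * (N+1-k) : ℕ) : ℝ) := fun k y =>
    div_nonneg (mul_nonneg (hn _ _) (hn _ _)) (Nat.cast_nonneg _)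
  rw [integral_eq_lintegral_of_nonneg_ae]
  rotate_left
  · filter_upwards [ae_restrict_mem measurableSet_Ioi] with y hy
    exact mul_nonneg (le_of_lt hy) (Finset.sum_nonneg fun k _ => hterm k y)
  · exact Measurable.aestronglyMeasurable (by fun_prop)
  congr 1
  have hae : ∀ᵐ y, ∀ n, ENNReal.ofReal (convN ρ n y) = lcv (fun x => ENNReal.ofReal (ρ x)) n y :=
    ae_all_iff.mpr (convN_ae hpos hm h1)
  have e1 : ∫⁻ y in Set.Ioi (0:ℝ), ENNReal.ofReal (y * ∑ k ∈ Finset.Icc 1 N,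
            convN ρ (k-1) y * convN ρ (N+1-k-1) y / ((k * (N+1-k) : ℕ) : ℝ))
      = ∫⁻ y in Set.Ioi (0:ℝ), ∑ k ∈ Finset.Icc 1 N, ((k * (N+1-k) : ℕ) : ℝ≥0∞)⁻¹ *
        (ENNReal.ofReal y * (lcv (fun x => ENNReal.ofReal (ρ x)) (k-1) y *
          lcv (fun x => ENNReal.ofReal (ρ x)) (N-k) y)) := by
    apply lintegral_congr_ae
    filter_upwards [ae_restrict_mem measurableSet_Ioi, ae_restrict_of_ae hae] with y hy hy2
    rw [ENNReal.ofReal_mul (le_of_lt hy), ENNReal.ofReal_sum_of_nonneg (fun k _ => hterm k y),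
      Finset.mul_sum]
    refine Finset.sum_congr rfl fun k hk => ?_
    simp only [Finset.mem_Icc] at hk
    have hkp : 0 < k * (N+1-k) := Nat.mul_pos (by omega) (by omega)
    rw [ENNReal.ofReal_div_of_pos (by exact_mod_cast hkp), ENNReal.ofReal_mul (hn _ _), hy2, hy2,
      ENNReal.ofReal_natCast, show N+1-k-1 = N-k by omega, div_eq_mul_inv]
    ring
  have e2 : ∀ F : ℝ → ℝ≥0∞, ∫⁻ y in Set.Ioi (0:ℝ), ENNReal.ofReal y * F y
      = ∫⁻ y, ENNReal.ofReal y * F y := by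
    intro F
    rw [← lintegral_indicator measurableSet_Ioi]
    refine lintegral_congr fun y => ?_
    by_cases hy : 0 < y
    · simp [Set.indicator, hy]
    · simp [Set.indicator, hy, ENNReal.ofReal_of_nonpos (not_lt.mp hy)]
  rw [e1, lintegral_finsetSum _ (by intro k _; fun_prop)]
  refine Finset.sum_congr rfl fun k hk => ?_
  rw [lintegral_const_mul _ (by fun_prop), e2]

lemma kac_aux {ρ : ℝ → ℝ} (hpos : ∀ x, 0 ≤ ρ x) (hm : Measurable ρ) (hone : ∫ x, ρ x = 1)
    (hs : ∀ x, ρ (-x) = ρ x) {N : ℕ} (hne : (Finset.range (N+1)).Nonempty) :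
    ∫ x : Fin N → ℝ, ((Finset.range (N+1)).sup' hne (fun k => ext x (k+1)))
          * ∏ i ∈ Finset.range (N+1), ρ (ext x (i+1) - ext x i)
     = (((N+1 : ℕ) : ℝ)/2) * ∫ y in Set.Ioi (0:ℝ), y * ∑ k ∈ Finset.Icc 1 N,
            convN ρ (k-1) y * convN ρ (N+1-k-1) y / ((k * (N+1-k) : ℕ) : ℝ) := by
  have h1 : ∫⁻ x, ENNReal.ofReal (ρ x) = 1 := by
    have hi : Integrable ρ := by
      by_contra h
      rw [integral_undef h] at hone
      exact zero_ne_one hone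
    rw [← ofReal_integral_eq_lintegral_ofReal hi (ae_of_all _ hpos), hone, ENNReal.ofReal_one]
  have hq : Measurable (fun x => ENNReal.ofReal (ρ x)) := by fun_prop
  rw [LHS_eq hpos hm hs, RHS_eq hpos hm h1,
    G_formula hq (fun x => by rw [hs]) N le_rfl]
  have hH := sym_sum (N := N) (fun k => ∫⁻ x, ENNReal.ofReal x *
    (lcv (fun x => ENNReal.ofReal (ρ x)) (k-1) x * lcv (fun x => ENNReal.ofReal (ρ x)) (N-k) x)) (by
      intro k hk1 hk2
      refine lintegral_congr fun x => ?_
      rw [show N+1-k-1 = N-k by omega, show N-(N+1-k) = k-1 by omega]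
      ring)
  have hre : ∑ k ∈ Finset.range N, ((k+1 : ℕ) : ℝ≥0∞)⁻¹ *
        ∫⁻ x, ENNReal.ofReal x * (lcv (fun x => ENNReal.ofReal (ρ x)) k x *
          lcv (fun x => ENNReal.ofReal (ρ x)) (N - (k+1)) x)
      = ∑ k ∈ Finset.Icc 1 N, (k : ℝ≥0∞)⁻¹ * ∫⁻ x, ENNReal.ofReal x *
    (lcv (fun x => ENNReal.ofReal (ρ x)) (k-1) x * lcv (fun x => ENNReal.ofReal (ρ x)) (N-k) x) := by
    refine Finset.sum_bij' (fun k _ => k+1) (fun k _ => k-1) ?_ ?_ ?_ ?_ ?_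
    · intro k hk; simp only [Finset.mem_Icc, Finset.mem_range] at hk ⊢; omega
    · intro k hk; simp only [Finset.mem_Icc, Finset.mem_range] at hk ⊢; omega
    · intro k hk; simp
    · intro k hk; simp only [Finset.mem_Icc] at hk; omega
    · intro k hk; simp
  rw [hre]
  have h2 := congrArg ENNReal.toReal hH
  rw [ENNReal.toReal_mul, ENNReal.toReal_mul, ENNReal.toReal_natCast, ENNReal.toReal_ofNat] at h2
  linarith

/-- Kac's formula: for a random walk bridge with continuous symmetric step
density `ρ`, the maximum-weighted density of return to 0 at step `n ≥ 2` satisfies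
`E[M_n δ_0(S_n)] = (n/2) ∫_0^∞ x ∑_{k=1}^{n-1} ρ^{*k}(x) ρ^{*(n−k)}(x)/(k(n−k)) dx`,
where `M_n = max_{1 ≤ k ≤ n} S_k` and the left side is the explicit multiple integral
over the bridge path `S_k = x_k` (`1 ≤ k ≤ n−1`), `S_0 = S_n = 0`. -/
theorem kac_formula
    (ρ : ℝ → ℝ) (hρpos : ∀ x, 0 ≤ ρ x) (hρint : ∫ x, ρ x = 1)
    (hρcont : Continuous ρ) (hρsymm : ∀ x, ρ (-x) = ρ x)
    (n : ℕ) (hn : 2 ≤ n) :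
    ∫ x : Fin (n-1) → ℝ,
        ((Finset.range n).sup' (Finset.nonempty_range_iff.mpr (by omega))
            (fun k => ext x (k+1)))
          * ∏ i ∈ Finset.range n, ρ (ext x (i+1) - ext x i)
      = ((n : ℝ)/2) * ∫ y in Set.Ioi (0:ℝ),
          y * ∑ k ∈ Finset.Icc 1 (n-1),
            convN ρ (k-1) y * convN ρ (n-k-1) y / ((k * (n-k) : ℕ) : ℝ) := by
  obtain ⟨N, rfl⟩ : ∃ N, n = N+1 := ⟨n-1, by omega⟩
  exact kac_aux hρpos hρcont.measurable hρint hρsymm _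
end

section
/- For λ ∈ (0,1) and x > 0, the integral I_λ(x) = (1/(2π)) ∫_ℝ e^{−ikx} log(1 − λ sech(kπ/2)) dk evaluates to I_λ(x) = (1/(2x)) · (cosh(x) − cosh(2x(1 − α/π)))/(sinh(x) cosh(x)), where α = arccos(λ) ∈ (0, π/2). -/
open MeasureTheory Real

lemma aux_laplace (b x : ℝ) (hb : 0 < b) :
    Integrable (fun k : ℝ => Complex.exp (-(Complex.I * k * x)) * (rexp (-b * |k|) : ℂ)) ∧
    ∫ k : ℝ, Complex.exp (-(Complex.I * k * x)) * (rexp (-b * |k|) : ℂ)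
      = ((2 * b / (b^2 + x^2) : ℝ) : ℂ) := by
  have e1 : Set.EqOn (fun k : ℝ => Complex.exp ((b - Complex.I * x) * k))
      (fun k : ℝ => Complex.exp (-(Complex.I * k * x)) * (rexp (-b * |k|) : ℂ)) (Set.Iic 0) := by
    intro k hk
    simp only [Set.mem_Iic] at hk
    simp only [abs_of_nonpos hk, Complex.ofReal_exp, ← Complex.exp_add]
    push_cast
    ring_nf
  have e2 : Set.EqOn (fun k : ℝ => Complex.exp ((-b - Complex.I * x) * k))
      (fun k : ℝ => Complex.exp (-(Complex.I * k * x)) * (rexp (-b * |k|) : ℂ)) (Set.Ioi 0) := by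
    intro k hk
    simp only [Set.mem_Ioi] at hk
    simp only [abs_of_pos hk, Complex.ofReal_exp, ← Complex.exp_add]
    push_cast
    ring_nf
  have r1 : 0 < ((b : ℂ) - Complex.I * x).re := by simpa using hb
  have r2 : (-(b : ℂ) - Complex.I * x).re < 0 := by simpa using hb
  have i1 := (integrableOn_exp_mul_complex_Iic r1 0).congr_fun e1 measurableSet_Iic
  have i2 := (integrableOn_exp_mul_complex_Ioi r2 0).congr_fun e2 measurableSet_Ioi
  refine ⟨?_, ?_⟩
  · rw [← integrableOn_univ, ← Set.Iic_union_Ioi (a := (0:ℝ))]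
    exact i1.union i2
  · rw [← intervalIntegral.integral_Iic_add_Ioi i1 i2, ← setIntegral_congr_fun measurableSet_Iic e1,
      ← setIntegral_congr_fun measurableSet_Ioi e2, integral_exp_mul_complex_Iic r1,
      integral_exp_mul_complex_Ioi r2]
    have n1 : (b : ℂ) - Complex.I * x ≠ 0 := by intro h; rw [h] at r1; simp at r1
    have n2 : -(b : ℂ) - Complex.I * x ≠ 0 := by intro h; rw [h] at r2; simp at r2
    have n3 : (b : ℂ)^2 + x^2 ≠ 0 := by
      have : b^2 + x^2 ≠ 0 := by positivity
      exact_mod_cast this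
    push_cast
    simp only [mul_zero, Complex.exp_zero]
    rw [div_add_div _ _ n1 n2, div_eq_div_iff (mul_ne_zero n1 n2) n3]
    ring_nf
    simp only [Complex.I_sq]
    ring

lemma aux_norm (b x : ℝ) (hb : 0 < b) :
    ∫ k : ℝ, ‖Complex.exp (-(Complex.I * k * x)) * (rexp (-b * |k|) : ℂ)‖ = 2 / b := by
  have : ∀ k : ℝ, ‖Complex.exp (-(Complex.I * k * x)) * (rexp (-b * |k|) : ℂ)‖
      = (fun t => rexp (-b * t)) |k| := by
    intro k
    rw [norm_mul, Complex.norm_exp, Complex.norm_real, Real.norm_of_nonneg (exp_pos _).le]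
    simp
  simp_rw [this]
  rw [integral_comp_abs (f := fun t => rexp (-b * t)), integral_exp_mul_Ioi (by linarith)]
  simp; field_simp

lemma aux_log1 (u θ : ℝ) (hu : 0 < u) :
    HasSum (fun n : ℕ => rexp (-u * n) * Real.cos (n * θ) / n)
      (-(1/2) * Real.log (2 * rexp (-u) * (Real.cosh u - Real.cos θ))) := by
  set z : ℂ := (rexp (-u) : ℂ) * Complex.exp (θ * Complex.I) with hz
  have hn : ‖z‖ < 1 := by
    rw [hz, norm_mul, Complex.norm_exp_ofReal_mul_I, Complex.norm_real,
      Real.norm_of_nonneg (exp_pos _).le, mul_one]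
    simpa using hu
  have h := Complex.hasSum_re (Complex.hasSum_taylorSeries_neg_log hn)
  convert h using 1
  · ext n
    have : z ^ n = ((rexp (-u * n) : ℝ) : ℂ) * Complex.exp ((n * θ : ℝ) * Complex.I) := by
      rw [hz, mul_pow, ← Complex.exp_nat_mul]
      push_cast
      rw [← Complex.exp_nat_mul]
      ring_nf
    rw [Complex.div_natCast_re, this, Complex.re_ofReal_mul, Complex.exp_ofReal_mul_I_re]
  · rw [Complex.neg_re, Complex.log_re]
    have h2 : ‖1 - z‖ ^ 2 = 2 * rexp (-u) * (Real.cosh u - Real.cos θ) := by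
      rw [Complex.sq_norm, Complex.normSq_apply]
      have a1 : z.re = rexp (-u) * Real.cos θ := by
        rw [hz, Complex.re_ofReal_mul, Complex.exp_ofReal_mul_I_re]
      have a2 : z.im = rexp (-u) * Real.sin θ := by
        rw [hz, Complex.im_ofReal_mul, Complex.exp_ofReal_mul_I_im]
      simp only [Complex.sub_re, Complex.sub_im, Complex.one_re, Complex.one_im, a1, a2]
      rw [Real.cosh_eq]
      have : rexp (-u) * rexp u = 1 := by rw [← Real.exp_add]; simp
      have := Real.sin_sq_add_cos_sq θ
      linear_combination rexp (-u)^2 * this - ‹rexp (-u) * rexp u = 1›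
    rw [← h2, Real.log_pow]
    push_cast
    ring

lemma aux_log (u l : ℝ) (hu : 0 < u) (h0 : 0 < l) (h1 : l < 1) :
    HasSum (fun n : ℕ => -2 * ((Real.cos (n * Real.arccos l) - Real.cos (n * (π/2))) / n) * rexp (-u * n))
      (Real.log (1 - l * (1 / Real.cosh u))) := by
  have hc : 1 < Real.cosh u := Real.one_lt_cosh.2 hu.ne'
  have hA := ((aux_log1 u (Real.arccos l) hu).sub (aux_log1 u (π/2) hu)).mul_left (-2)
  rw [Real.cos_arccos (by linarith) h1.le, Real.cos_pi_div_two, sub_zero,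
    Real.log_mul (x := 2 * rexp (-u)) (y := Real.cosh u - l) (by positivity) (by linarith),
    Real.log_mul (x := 2 * rexp (-u)) (y := Real.cosh u) (by positivity) (by linarith)] at hA
  have e : 1 - l * (1 / Real.cosh u) = (Real.cosh u - l) / Real.cosh u := by
    field_simp
  rw [e, Real.log_div (by linarith) (by linarith)]
  convert! hA using 1
  · funext n; ring_nf
  · ring

lemma aux_coeff (c : ℝ) (hc : 0 < c) (n : ℤ) :
    ∫ t in (0:ℝ)..1, fourier (-n) (t : AddCircle (1:ℝ)) • ((Real.cosh (c * (1 - 2 * t)) : ℝ) : ℂ)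
      = ((c * Real.sinh c / (c^2 + π^2 * n^2) : ℝ) : ℂ) := by
  have key : ∀ t : ℝ, fourier (-n) (t : AddCircle (1:ℝ)) • ((Real.cosh (c * (1 - 2 * t)) : ℝ) : ℂ)
      = (Complex.exp c / 2) * Complex.exp ((-2 * c - 2 * π * Complex.I * n) * t)
       + (Complex.exp (-c) / 2) * Complex.exp ((2 * c - 2 * π * Complex.I * n) * t) := by
    intro t
    rw [fourier_coe_apply, smul_eq_mul, Complex.ofReal_cosh, Complex.cosh]
    rw [div_mul_eq_mul_div, div_mul_eq_mul_div, ← Complex.exp_add, ← Complex.exp_add, mul_div_assoc',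
      mul_add, ← Complex.exp_add, ← Complex.exp_add, add_div]
    push_cast
    congr 3 <;> ring
  have n1 : (-2 * c - 2 * π * Complex.I * n : ℂ) ≠ 0 := by
    intro h
    have := congrArg Complex.re h
    simp at this; exact hc.ne' this
  have n2 : (2 * c - 2 * π * Complex.I * n : ℂ) ≠ 0 := by
    intro h
    have := congrArg Complex.re h
    simp at this; exact hc.ne' this
  have n3 : (c : ℂ)^2 + π^2 * n^2 ≠ 0 := by
    have : c^2 + π^2 * n^2 ≠ 0 := by positivity
    exact_mod_cast this
  simp_rw [key]
  rw [intervalIntegral.integral_add (by apply Continuous.intervalIntegrable; fun_prop)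
    (by apply Continuous.intervalIntegrable; fun_prop),
    intervalIntegral.integral_const_mul, intervalIntegral.integral_const_mul,
    integral_exp_mul_complex n1, integral_exp_mul_complex n2]
  have p : Complex.exp (- (2 * π * Complex.I * n)) = 1 := by
    rw [Complex.exp_eq_one_iff]; exact ⟨-n, by push_cast; ring⟩
  have q1 : Complex.exp ((-2 * c - 2 * π * Complex.I * n) * (1:ℝ)) = Complex.exp (-c) ^ 2 := by
    rw [← Complex.exp_nat_mul, Complex.ofReal_one, mul_one, sub_eq_add_neg, Complex.exp_add, p, mul_one]
    congr 1; push_cast; ring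
  have q2 : Complex.exp ((2 * c - 2 * π * Complex.I * n) * (1:ℝ)) = Complex.exp (c) ^ 2 := by
    rw [← Complex.exp_nat_mul, Complex.ofReal_one, mul_one, sub_eq_add_neg, Complex.exp_add, p, mul_one]
    congr 1
  have q3 : Complex.exp c * Complex.exp (-c) = 1 := by rw [← Complex.exp_add]; simp
  rw [q1, q2]
  push_cast
  rw [Complex.sinh]
  simp only [mul_zero, Complex.exp_zero]
  generalize Complex.exp c = A at *
  generalize Complex.exp (-c) = B at *
  have hI := Complex.I_sq
  have s1 : A / 2 * ((B^2 - 1) / (-2 * c - 2 * π * Complex.I * n)) = ((B - A) / 2) / (-2 * c - 2 * π * Complex.I * n) := by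
    rw [mul_div_assoc']; congr 1; linear_combination B / 2 * q3
  have s2 : B / 2 * ((A^2 - 1) / (2 * c - 2 * π * Complex.I * n)) = ((A - B) / 2) / (2 * c - 2 * π * Complex.I * n) := by
    rw [mul_div_assoc']; congr 1; linear_combination A / 2 * q3
  rw [s1, s2, div_add_div _ _ n1 n2, div_eq_div_iff (mul_ne_zero n1 n2) n3]
  linear_combination (-2 * c * (A - B) * π^2 * n^2) * hI

lemma aux_summ (c : ℝ) (hc : 0 < c) :
    Summable (fun n : ℤ => ((c * Real.sinh c / (c^2 + π^2 * n^2) : ℝ) : ℂ)) := by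
  rw [Complex.summable_ofReal]
  have : Summable (fun n : ℤ => (c * Real.sinh c / π^2) * (1 / (n:ℝ)^2)) :=
    (Real.summable_one_div_int_pow.2 (by norm_num)).mul_left _
  have hs : 0 < Real.sinh c := Real.sinh_pos_iff.2 hc
  refine this.of_norm_bounded_eventually ?_
  rw [Filter.eventually_cofinite]
  refine (Set.finite_singleton (0:ℤ)).subset ?_
  intro n hn
  by_contra h0
  apply hn
  have h0' : (n:ℝ) ≠ 0 := by exact_mod_cast h0
  rw [Real.norm_of_nonneg (by positivity), div_mul_div_comm, mul_one]
  gcongr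
  nlinarith [sq_nonneg c]

lemma aux_fourier (c : ℝ) (hc : 0 < c) (t : ℝ) (ht : t ∈ Set.Ico (0:ℝ) 1) :
    HasSum (fun n : ℤ => ((c * Real.sinh c / (c^2 + π^2 * n^2) : ℝ) : ℂ) * fourier n (t : AddCircle (1:ℝ)))
      ((Real.cosh (c * (1 - 2 * t)) : ℝ) : ℂ) := by
  let f : ℝ → ℂ := fun t => ((Real.cosh (c * (1 - 2 * t)) : ℝ) : ℂ)
  have hf : Continuous (AddCircle.liftIco (1:ℝ) 0 f) := by
    apply AddCircle.liftIco_zero_continuous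
    · simp only [f]
      congr 1
      rw [← Real.cosh_neg]; congr 1; ring
    · apply Continuous.continuousOn
      simp only [f]
      have := Real.continuous_cosh
      fun_prop
  let B : C(AddCircle (1:ℝ), ℂ) := ⟨_, hf⟩
  have step1 : ∀ n : ℤ, fourierCoeff B n = ((c * Real.sinh c / (c^2 + π^2 * n^2) : ℝ) : ℂ) := by
    intro n
    rw [← aux_coeff c hc n]
    simp only [B, ContinuousMap.coe_mk]
    rw [fourierCoeff_eq_intervalIntegral _ _ 0]
    simp only [zero_add, div_one, one_smul]
    refine intervalIntegral.integral_congr_Ioo_of_le zero_le_one fun x hx => ?_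
    rw [AddCircle.liftIco_coe_apply (by simpa using Set.Ioo_subset_Ico_self hx)]
  have step2 := has_pointwise_sum_fourier_series_of_summable
      ((aux_summ c hc).congr fun n => (step1 n).symm) (t : AddCircle (1:ℝ))
  simp_rw [step1] at step2
  convert! step2 using 1
  change f t = AddCircle.liftIco (1:ℝ) 0 f t
  rw [AddCircle.liftIco_coe_apply (by simpa using ht)]

lemma aux_cos (c : ℝ) (hc : 0 < c) (a : ℝ) (ha : 0 ≤ a) (ha' : a < 2 * π) (b : ℝ) (hb : 0 ≤ b) (hb' : b < 2 * π) :
    HasSum (fun n : ℕ => 2 * (c * Real.sinh c / (c^2 + π^2 * n^2)) * (Real.cos (n * a) - Real.cos (n * b)))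
      (Real.cosh (c * (1 - a / π)) - Real.cosh (c * (1 - b / π))) := by
  have hp := Real.pi_pos
  have h1 := aux_fourier c hc (a / (2 * π)) ⟨by positivity, by rw [div_lt_one (by positivity)]; exact ha'⟩
  have h2 := aux_fourier c hc (b / (2 * π)) ⟨by positivity, by rw [div_lt_one (by positivity)]; exact hb'⟩
  have h := Complex.hasSum_re (h1.sub h2).nat_add_neg
  have hre : ∀ (n : ℤ) (s : ℝ), (fourier n ((s / (2 * π) : ℝ) : AddCircle (1:ℝ)) : ℂ).re = Real.cos (n * s) := by
    intro n s
    rw [fourier_coe_apply, ← Complex.exp_ofReal_mul_I_re]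
    congr 2
    push_cast
    have : (π : ℂ) ≠ 0 := by exact_mod_cast hp.ne'
    field_simp
  convert h using 1
  · ext n
    simp only [Complex.add_re, Complex.sub_re, Complex.re_ofReal_mul, hre]
    push_cast
    simp only [neg_mul, Real.cos_neg, neg_sq]
    ring
  · simp only [Complex.add_re, Complex.sub_re, Complex.re_ofReal_mul, hre, Complex.ofReal_re]
    simp
    congr 2 <;> field_simp

theorem sech_log_fourier_transform (l x : ℝ) (hl : l ∈ Set.Ioo (0:ℝ) 1) (hx : 0 < x) :
    (1 / (2 * (π : ℂ))) * ∫ k : ℝ, Complex.exp (-(Complex.I * k * x)) *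
        (Real.log (1 - l * (1 / Real.cosh (k * π / 2))) : ℂ)
      = (((1 / (2*x)) * (Real.cosh x - Real.cosh (2*x*(1 - Real.arccos l / π)))
          / (Real.sinh x * Real.cosh x) : ℝ) : ℂ) := by
  obtain ⟨h0, h1⟩ := hl
  have hp := Real.pi_pos
  set a : ℕ → ℝ := fun n => -2 * ((Real.cos (n * Real.arccos l) - Real.cos (n * (π/2))) / n) with ha
  let F : ℕ → ℝ → ℂ := fun n k => (a n : ℂ) *
    (Complex.exp (-(Complex.I * k * x)) * (rexp (-(n * π / 2) * |k|) : ℂ))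
  have a0 : a 0 = 0 := by simp [ha]
  have hb : ∀ n : ℕ, n ≠ 0 → 0 < (n * π / 2 : ℝ) := by
    intro n hn
    have : 0 < (n:ℝ) := by exact_mod_cast Nat.pos_of_ne_zero hn
    positivity
  have hFi : ∀ n, Integrable (F n) := by
    intro n
    by_cases hn : n = 0
    · subst hn; simp [F, a0]
    · exact (aux_laplace _ x (hb n hn)).1.const_mul _
  have hFn : ∀ n, ∫ k, ‖F n k‖ = |a n| * (2 / (n * π / 2)) := by
    intro n
    by_cases hn : n = 0
    · subst hn; simp [F, a0]
    · rw [← aux_norm _ x (hb n hn), ← integral_const_mul]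
      simp only [F]
      congr 1; ext k
      rw [norm_mul (a n : ℂ), Complex.norm_real, Real.norm_eq_abs]
  have hFs : Summable (fun n => ∫ k, ‖F n k‖) := by
    simp_rw [hFn]
    have hs : Summable (fun n : ℕ => (16 / π) * (1 / (n:ℝ)^2)) :=
      (Real.summable_one_div_nat_pow.2 (by norm_num)).mul_left _
    refine Summable.of_nonneg_of_le (fun n => by positivity) (fun n => ?_) hs
    by_cases hn : n = 0
    · subst hn; simp
    · have hn' : 0 < (n:ℝ) := by exact_mod_cast Nat.pos_of_ne_zero hn
      have : |a n| ≤ 4 / n := by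
        simp only [ha]
        rw [abs_mul, abs_div, abs_of_pos hn']
        have : |Real.cos (n * Real.arccos l) - Real.cos (n * (π/2))| ≤ 2 := by
          rw [abs_le]
          constructor <;> linarith [Real.cos_le_one (n * Real.arccos l), Real.neg_one_le_cos (n * Real.arccos l),
            Real.cos_le_one (n * (π/2)), Real.neg_one_le_cos (n * (π/2))]
        rw [mul_div_assoc']
        gcongr
        norm_num
        linarith
      calc |a n| * (2 / (n * π / 2)) ≤ 4 / n * (2 / (n * π / 2)) := by gcongr
        _ = (16 / π) * (1 / (n:ℝ)^2) := by field_simp; norm_num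
  have H := hasSum_integral_of_summable_integral_norm hFi hFs
  have hlim : ∫ k, (∑' n, F n k) = ∫ k : ℝ, Complex.exp (-(Complex.I * k * x)) *
        (Real.log (1 - l * (1 / Real.cosh (k * π / 2))) : ℂ) := by
    apply integral_congr_ae
    have : ∀ᵐ k : ℝ, k ≠ 0 := by simp [ae_iff]
    filter_upwards [this] with k hk
    have hk' : 0 < |k| := abs_pos.2 hk
    have h := aux_log (|k| * π / 2) l (by positivity) h0 h1
    have hcosh : Real.cosh (|k| * π / 2) = Real.cosh (k * π / 2) := by
      rw [← Real.cosh_abs (k * π / 2)]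
      congr 1
      rw [abs_div, abs_mul, abs_of_pos hp, abs_two]
    rw [hcosh] at h
    have h2 := (Complex.hasSum_ofReal.2 h).mul_left (Complex.exp (-(Complex.I * k * x)))
    rw [← h2.tsum_eq]
    congr 1; ext n
    simp only [F, ha]
    rw [show -(n * π / 2) * |k| = -(|k| * π / 2) * n by ring]
    push_cast
    ring
  rw [hlim] at H
  have hs : 0 < Real.sinh (2 * x) := Real.sinh_pos_iff.2 (by positivity)
  have hal : 0 ≤ Real.arccos l := Real.arccos_nonneg l
  have hC := aux_cos (2 * x) (by positivity) (Real.arccos l) hal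
    (by linarith [Real.arccos_le_pi l]) (π/2) (by positivity) (by linarith)
  have hC2 := Complex.hasSum_ofReal.2 (hC.mul_left (-(4 * π) / (2 * x * Real.sinh (2 * x))))
  have hval : ∀ n : ℕ, ∫ k, F n k = ((-(4 * π) / (2 * x * Real.sinh (2 * x)) * (2 * (2 * x * Real.sinh (2 * x) / ((2 * x)^2 + π^2 * n^2)) * (Real.cos (n * Real.arccos l) - Real.cos (n * (π/2)))) : ℝ) : ℂ) := by
    intro n
    by_cases hn : n = 0
    · subst hn; simp [F, a0]
    · simp only [F]
      rw [integral_const_mul, (aux_laplace _ x (hb n hn)).2, ← Complex.ofReal_mul]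
      congr 1
      have hn' : 0 < (n:ℝ) := by exact_mod_cast Nat.pos_of_ne_zero hn
      simp only [ha]
      field_simp
      ring
  simp_rw [hval] at H
  rw [H.unique hC2]
  have hsx : 0 < Real.sinh x := Real.sinh_pos_iff.2 hx
  have hcx : 0 < Real.cosh x := Real.cosh_pos x
  rw [show (1 / (2 * (π : ℂ))) = ((1 / (2 * π) : ℝ) : ℂ) by push_cast; rfl, ← Complex.ofReal_mul]
  congr 1
  rw [show 2 * x * (1 - π / 2 / π) = x by field_simp; ring, Real.sinh_two_mul]
  field_simp
  ring
end

section
/- For x > 0, the value at λ = 1 of the integral I_λ(x) = (1/(2π)) ∫_ℝ e^{−ikx} log(1 − λ sech(kπ/2)) dk is given by I_1(x) = −(1/(2x))(tanh(x) + tanh(x/2)). -/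
open MeasureTheory Real

lemma aux_exp (x a : ℝ) (ha : 0 < a) :
    Integrable (fun k : ℝ => Complex.exp (-(Complex.I * k * x)) * (Real.exp (-(a * |k|)) : ℂ)) ∧
    ∫ k : ℝ, Complex.exp (-(Complex.I * k * x)) * (Real.exp (-(a * |k|)) : ℂ)
      = ((2 * a / (a ^ 2 + x ^ 2) : ℝ) : ℂ) := by
  have h1 : (-(a:ℂ) - Complex.I * x).re < 0 := by simp [ha]
  have h2 : 0 < ((a:ℂ) - Complex.I * x).re := by simp [ha]
  have e1 : Set.EqOn (fun k : ℝ => Complex.exp ((-(a:ℂ) - Complex.I * x) * k))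
      (fun k : ℝ => Complex.exp (-(Complex.I * k * x)) * (Real.exp (-(a * |k|)) : ℂ))
      (Set.Ioi 0) := by
    intro k hk
    have hk' : 0 < k := hk
    simp only [abs_of_pos hk', Complex.ofReal_exp, ← Complex.exp_add]
    push_cast
    ring_nf
  have e2 : Set.EqOn (fun k : ℝ => Complex.exp (((a:ℂ) - Complex.I * x) * k))
      (fun k : ℝ => Complex.exp (-(Complex.I * k * x)) * (Real.exp (-(a * |k|)) : ℂ))
      (Set.Iic 0) := by
    intro k hk
    have hk' : k ≤ 0 := hk
    simp only [abs_of_nonpos hk', Complex.ofReal_exp, ← Complex.exp_add]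
    push_cast
    ring_nf
  have i1 := (integrableOn_exp_mul_complex_Ioi h1 0).congr_fun e1 measurableSet_Ioi
  have i2 := (integrableOn_exp_mul_complex_Iic h2 0).congr_fun e2 measurableSet_Iic
  constructor
  · rw [← integrableOn_univ, ← Set.Iic_union_Ioi (a := (0:ℝ))]
    exact i2.union i1
  · rw [← intervalIntegral.integral_Iic_add_Ioi i2 i1,
      ← setIntegral_congr_fun measurableSet_Ioi e1, ← setIntegral_congr_fun measurableSet_Iic e2,
      integral_exp_mul_complex_Ioi h1, integral_exp_mul_complex_Iic h2]
    have n1 : (-(a:ℂ) - Complex.I * x) ≠ 0 := fun h => by simp [h] at h1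
    have n2 : ((a:ℂ) - Complex.I * x) ≠ 0 := fun h => by simp [h] at h2
    have n3 : ((a:ℂ)^2 + x^2) ≠ 0 := by
      have : (a^2 + x^2) ≠ 0 := by positivity
      exact_mod_cast this
    simp only [Complex.ofReal_zero, mul_zero, Complex.exp_zero]
    push_cast
    field_simp
    ring_nf
    simp only [Complex.I_sq]
    ring

lemma aux_log_s8 (x c : ℝ) (hc : 0 < c) :
    HasSum (fun n : ℕ => ((-(2 * c / (((n + 1 : ℝ) * c) ^ 2 + x ^ 2)) : ℝ) : ℂ))
    (∫ k : ℝ, Complex.exp (-(Complex.I * k * x)) * (Real.log (1 - Real.exp (-(c * |k|))) : ℂ)) := by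
  set F : ℕ → ℝ → ℂ := fun n k => (-(1 / (n + 1 : ℝ)) : ℝ) *
    (Complex.exp (-(Complex.I * k * x)) * (Real.exp (-(((n + 1 : ℝ) * c) * |k|)) : ℂ)) with hF
  have hpos : ∀ n : ℕ, 0 < (n + 1 : ℝ) * c := fun n => by positivity
  have hint : ∀ n, Integrable (F n) := fun n => ((aux_exp x _ (hpos n)).1).const_mul _
  have hnorm : ∀ n, ∫ k, ‖F n k‖ = (2 / c) * (1 / ((n + 1 : ℕ) : ℝ) ^ 2) := by
    intro n
    have h := (aux_exp 0 _ (hpos n)).2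
    have h' : ∫ k : ℝ, Real.exp (-(((n + 1 : ℝ) * c) * |k|)) = 2 / ((n + 1 : ℝ) * c) := by
      simp only [Complex.ofReal_zero, mul_zero, neg_zero, Complex.exp_zero, one_mul] at h
      rw [integral_complex_ofReal] at h
      have := Complex.ofReal_injective h
      rw [this]
      have := (hpos n).ne'
      field_simp
      ring
    have e : ∀ k, ‖F n k‖ = (1 / (n + 1 : ℝ)) * Real.exp (-(((n + 1 : ℝ) * c) * |k|)) := by
      intro k
      have : ‖Complex.exp (-(Complex.I * k * x))‖ = 1 := by
        rw [Complex.norm_exp]; simp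
      simp only [hF, norm_mul, this, Complex.norm_real, Real.norm_eq_abs, Real.abs_exp, abs_neg]
      rw [abs_of_pos (by positivity)]
      ring
    simp_rw [e]
    rw [integral_const_mul, h']
    push_cast
    field_simp
  have hsum : Summable fun n => ∫ k, ‖F n k‖ := by
    simp_rw [hnorm]
    apply Summable.mul_left
    exact (summable_nat_add_iff 1).2 (Real.summable_one_div_nat_pow.2 one_lt_two)
  have key := hasSum_integral_of_summable_integral_norm hint hsum
  have e1 : ∀ n, ∫ k, F n k = ((-(2 * c / (((n + 1 : ℝ) * c) ^ 2 + x ^ 2)) : ℝ) : ℂ) := by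
    intro n
    simp only [hF]
    rw [integral_const_mul, (aux_exp x _ (hpos n)).2, ← Complex.ofReal_mul]
    congr 1
    have : (n + 1 : ℝ) ≠ 0 := by positivity
    field_simp
  simp_rw [e1] at key
  suffices hh : (∫ k : ℝ, Complex.exp (-(Complex.I * k * x)) *
      (Real.log (1 - Real.exp (-(c * |k|))) : ℂ)) = ∫ k, ∑' n, F n k by
    rw [hh]; exact key
  apply integral_congr_ae
  have : ∀ᵐ k : ℝ, k ≠ 0 := by simp [ae_iff]
  filter_upwards [this] with k hk
  have hq : |Real.exp (-(c * |k|))| < 1 := by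
    rw [Real.abs_exp, Real.exp_lt_one_iff]
    have : 0 < |k| := abs_pos.2 hk
    have := mul_pos hc this
    linarith
  have h := (Real.hasSum_pow_div_log_of_abs_lt_one hq)
  have h2 := ((Complex.hasSum_ofReal.2 h).mul_left (-Complex.exp (-(Complex.I * k * x)))).tsum_eq
  have h3 : ∀ n, F n k = -Complex.exp (-(Complex.I * k * x)) *
      ((Real.exp (-(c * |k|)) ^ (n + 1) / ((n:ℝ) + 1) : ℝ) : ℂ) := by
    intro n
    simp only [hF]
    rw [← Real.exp_nat_mul]
    push_cast
    have : (((n + 1 : ℂ)) * -(c * (|k| : ℝ))) = -((n + 1) * c * (|k| : ℝ)) := by ring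
    rw [this]
    ring
  simp_rw [h3]
  rw [h2]
  push_cast
  ring

lemma aux_int (x c : ℝ) (hc : 0 < c) : Integrable (fun k : ℝ =>
    Complex.exp (-(Complex.I * k * x)) * (Real.log (1 - Real.exp (-(c * |k|))) : ℂ)) := by
  by_contra h
  have hs := aux_log_s8 x c hc
  rw [integral_undef h, ← Complex.ofReal_zero, Complex.hasSum_ofReal] at hs
  have hs' := hs.neg
  simp only [neg_neg, neg_zero] at hs'
  have hp : ∀ n : ℕ, 0 < 2 * c / (((n + 1 : ℝ) * c) ^ 2 + x ^ 2) := fun n => by positivity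
  have := hs'.summable.tsum_pos (fun n => (hp n).le) 0 (hp 0)
  rw [hs'.tsum_eq] at this
  exact lt_irrefl _ this

lemma aux_val (x c : ℝ) (hx : 0 < x) (hc : 0 < c) :
    (∫ k : ℝ, Complex.exp (-(Complex.I * k * x)) * (Real.log (1 - Real.exp (-(c * |k|))) : ℂ))
      = ((-(1 / x) * (π * (Real.cosh (π * x / c) / Real.sinh (π * x / c)) - c / x) : ℝ) : ℂ) := by
  rw [← (aux_log_s8 x c hc).tsum_eq]
  set y : ℝ := x / c with hy
  have hy0 : 0 < y := by positivity
  have hz : (Complex.I * y) ∈ Complex.integerComplement := by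
    rw [Complex.mem_integerComplement_iff]
    rintro ⟨n, hn⟩
    have := congrArg Complex.im hn
    simp at this
    exact hy0.ne this
  have h := cot_series_rep' hz
  have hs0 : Real.sinh (π * y) ≠ 0 := (Real.sinh_pos_iff.2 (by positivity)).ne'
  have hs : (Complex.sinh (π * y)) ≠ 0 := by exact_mod_cast hs0
  have hcot : Complex.cot (π * (Complex.I * y)) =
      -Complex.I * (Complex.cosh (π * y) / Complex.sinh (π * y)) := by
    rw [show (π:ℂ) * (Complex.I * y) = (π * y) * Complex.I by ring, Complex.cot_eq_cos_div_sin,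
      Complex.cos_mul_I, Complex.sin_mul_I]
    field_simp
    simp
  have hyc : (y:ℂ) ≠ 0 := by exact_mod_cast hy0.ne'
  have hcc : (c:ℂ) ≠ 0 := by exact_mod_cast hc.ne'
  have hxy : x = y * c := by rw [hy]; field_simp
  have ht : ∀ n : ℕ, ((-(2 * c / (((n + 1 : ℝ) * c) ^ 2 + x ^ 2)) : ℝ) : ℂ) =
     (1 / (Complex.I * x)) * (1 / (Complex.I * y - (n + 1)) + 1 / (Complex.I * y + (n + 1))) := by
    intro n
    have n1 : (Complex.I * y - (n + 1)) ≠ 0 := fun h => by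
      have := congrArg Complex.im h
      simp at this
      exact hy0.ne' this
    have n2 : (Complex.I * y + (n + 1)) ≠ 0 := fun h => by
      have := congrArg Complex.im h
      simp at this
      exact hy0.ne' this
    have n3 : (((n:ℂ) + 1)^2 + y^2) ≠ 0 := by
      have : (((n:ℝ) + 1)^2 + y^2) ≠ 0 := by positivity
      exact_mod_cast this
    have hI := Complex.I_sq
    have n4 : ((((n:ℂ) + 1) * c)^2 + (y * c)^2) ≠ 0 := by
      rw [show ((((n:ℂ) + 1) * c)^2 + (y * c)^2) = (((n:ℂ) + 1)^2 + y^2) * c^2 by ring]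
      positivity
    rw [hxy]
    push_cast
    rw [div_add_div _ _ n1 n2, ← neg_div, div_mul_div_comm, div_eq_div_iff n4 
      (mul_ne_zero (mul_ne_zero Complex.I_ne_zero (mul_ne_zero hyc hcc)) (mul_ne_zero n1 n2))]
    linear_combination (-2 * c^2 * y^3 * Complex.I) * hI
  simp_rw [ht]
  rw [tsum_mul_left, ← h, hcot, show π * x / c = π * y by rw [hy]; ring, hxy]
  push_cast
  field_simp
  ring_nf
  simp only [Complex.I_sq]

theorem sech_log_fourier_transform_at_one (x : ℝ) (hx : 0 < x) :
    (1 / (2 * (π : ℂ))) * ∫ k : ℝ, Complex.exp (-(Complex.I * k * x)) *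
        (Real.log (1 - 1 * (1 / Real.cosh (k * π / 2))) : ℂ)
      = ((-(1 / (2*x)) * (Real.tanh x + Real.tanh (x/2)) : ℝ) : ℂ) := by
  have p1 : 0 < π / 2 := by positivity
  have p2 := Real.pi_pos
  have p3 : 0 < 2 * π := by positivity
  have hE : (∫ k : ℝ, Complex.exp (-(Complex.I * k * x)) *
        (Real.log (1 - 1 * (1 / Real.cosh (k * π / 2))) : ℂ)) =
      ∫ k : ℝ, (2 * (Complex.exp (-(Complex.I * k * x)) *
          (Real.log (1 - Real.exp (-(π / 2 * |k|))) : ℂ))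
        - Complex.exp (-(Complex.I * k * x)) * (Real.log (1 - Real.exp (-(2 * π * |k|))) : ℂ))
        + Complex.exp (-(Complex.I * k * x)) * (Real.log (1 - Real.exp (-(π * |k|))) : ℂ) := by
    apply integral_congr_ae
    have : ∀ᵐ k : ℝ, k ≠ 0 := by simp [ae_iff]
    filter_upwards [this] with k hk
    have hlog : Real.log (1 - 1 * (1 / Real.cosh (k * π / 2))) =
        2 * Real.log (1 - Real.exp (-(π / 2 * |k|))) - Real.log (1 - Real.exp (-(2 * π * |k|)))
        + Real.log (1 - Real.exp (-(π * |k|))) := by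
      have hk' : 0 < |k| := abs_pos.2 hk
      set q := Real.exp (-(π / 2 * |k|)) with hq
      have q0 : 0 < q := Real.exp_pos _
      have q1 : q < 1 := by
        rw [hq, Real.exp_lt_one_iff]
        have := mul_pos p1 hk'
        linarith
      have e2 : Real.exp (-(π * |k|)) = q ^ 2 := by
        rw [hq, ← Real.exp_nat_mul]; congr 1; push_cast; ring
      have e4 : Real.exp (-(2 * π * |k|)) = q ^ 4 := by
        rw [hq, ← Real.exp_nat_mul]; congr 1; push_cast; ring
      have ec : Real.cosh (k * π / 2) = (q⁻¹ + q) / 2 := by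
        rw [← Real.cosh_abs, Real.cosh_eq, hq, ← Real.exp_neg, neg_neg, abs_div, abs_mul,
          abs_of_pos p2, abs_of_pos (zero_lt_two' ℝ)]
        ring_nf
      have r1 : 1 - q ≠ 0 := by linarith
      have r2 : 1 - q ^ 2 ≠ 0 := by nlinarith
      have r3 : 1 - q ^ 4 = (1 - q ^ 2) * (1 + q ^ 2) := by ring
      have r4 : 1 + q ^ 2 ≠ 0 := by positivity
      have r5 : 1 - 1 * (1 / ((q⁻¹ + q) / 2)) = (1 - q) ^ 2 / (1 + q ^ 2) := by
        field_simp
        ring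
      rw [e2, e4, ec, r5, r3, Real.log_mul r2 r4, Real.log_div (pow_ne_zero 2 r1) r4, Real.log_pow]
      push_cast
      ring
    rw [hlog]
    push_cast
    ring
  have i3 : Integrable (fun k : ℝ => 2 * (Complex.exp (-(Complex.I * k * x)) *
          (Real.log (1 - Real.exp (-(π / 2 * |k|))) : ℂ))
        - Complex.exp (-(Complex.I * k * x)) *
          (Real.log (1 - Real.exp (-(2 * π * |k|))) : ℂ)) :=
    ((aux_int x _ p1).const_mul 2).sub (aux_int x _ p3)
  rw [hE, integral_add i3 (aux_int x _ p2),
    integral_sub ((aux_int x _ p1).const_mul 2) (aux_int x _ p3), integral_const_mul,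
    aux_val x _ hx p1, aux_val x _ hx p2, aux_val x _ hx p3]
  have h2 : π * x / (π / 2) = 2 * (2 * (x / 2)) := by field_simp
  have h3 : π * x / π = 2 * (x / 2) := by field_simp
  have h4 : π * x / (2 * π) = x / 2 := by field_simp
  have h5 : x = 2 * (x / 2) := by ring
  rw [h2, h3, h4]
  norm_cast
  rw [Real.tanh_eq_sinh_div_cosh, Real.tanh_eq_sinh_div_cosh]
  set w := x / 2 with hw
  have hw0 : 0 < w := by positivity
  rw [h5]
  have s0 : Real.sinh w ≠ 0 := (Real.sinh_pos_iff.2 hw0).ne'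
  have c0 : Real.cosh w ≠ 0 := (Real.cosh_pos w).ne'
  have c1 : Real.cosh (2 * w) ≠ 0 := (Real.cosh_pos _).ne'
  have hsq := Real.cosh_sq w
  have a1 : Real.cosh (2 * (2 * w)) / Real.sinh (2 * (2 * w)) =
      (Real.sinh (2 * w) / Real.cosh (2 * w) + Real.cosh (2 * w) / Real.sinh (2 * w)) / 2 := by
    have s1 : Real.sinh (2 * w) ≠ 0 := (Real.sinh_pos_iff.2 (by positivity)).ne'
    rw [Real.cosh_two_mul (2 * w), Real.sinh_two_mul (2 * w)]
    field_simp
    ring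
  have a2 : Real.cosh (2 * w) / Real.sinh (2 * w) =
      (Real.sinh w / Real.cosh w + Real.cosh w / Real.sinh w) / 2 := by
    rw [Real.cosh_two_mul w, Real.sinh_two_mul w]
    field_simp
    ring
  rw [a1, a2]
  generalize Real.sinh (2 * w) / Real.cosh (2 * w) = A
  field_simp
  ring
end
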